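/- For b > 2, z in the upper half-plane (Im z > 0), and coefficients g(n) with |g(n)| ≤ n·τ_d(n), the integral ∫_b^{b+i∞} (∑_{n=1}^∞ g(n) n^{-s}) e^{zs} ds equals -e^{bz} ∑_{n=1}^∞ g(n)/(n^b (z - log n)), where the interchange of summation and integration is valid; the resulting series defines a meromorphic function of z on ℂ with simple poles exactly at the points z = log n for those n with g(n) ≠ 0. -/

import Mathlib

open Complex Filter Topology MeasureTheory Finset

/-- `tau d n` is the `d`-th divisor function `τ_d(n)`. -/
def tau : ℕ → ℕ → ℕ
  | 0, n => if n = 1 then 1 else 0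
  | (d + 1), n => ∑ k ∈ n.divisors, tau d k

lemma exists_arithmeticFunction_eq_tau (d : ℕ) : ∃ f : ArithmeticFunction ℂ,
    (∀ n, f n = tau d n) ∧ ∀ s : ℂ, 1 < s.re → LSeriesSummable (fun n ↦ f n) s := by
  induction d with
  | zero =>
    refine ⟨1, fun n ↦ ?_, fun s _ ↦ ?_⟩
    · by_cases h : n = 1 <;> simp [tau, h]
    · rw [ArithmeticFunction.one_eq_delta]
      refine summable_of_ne_finset_zero (s := {1}) fun n hn ↦ ?_
      rw [Finset.mem_singleton] at hn
      simp [LSeries.term_def, LSeries.delta, hn]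
  | succ d ih =>
    obtain ⟨f, hf, hs⟩ := ih
    refine ⟨f * (ArithmeticFunction.zeta : ArithmeticFunction ℂ), fun n ↦ ?_, fun s h ↦ ?_⟩
    · rw [ArithmeticFunction.coe_mul_zeta_apply]
      simp [tau, hf]
    · exact ArithmeticFunction.LSeriesSummable_mul (hs s h)
        (ArithmeticFunction.LSeriesSummable_zeta_iff.mpr h)

lemma summable_tau_div_rpow (d : ℕ) {σ : ℝ} (hσ : 1 < σ) :
    Summable fun n : ℕ+ ↦ (tau d n : ℝ) / (n : ℝ) ^ σ := by
  obtain ⟨f, hf, hs⟩ := exists_arithmeticFunction_eq_tau d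
  refine ((hs σ (by simpa using hσ)).norm.comp_injective PNat.coe_injective).congr fun n ↦ ?_
  simp [LSeries.norm_term_eq, hf]

lemma summable_norm_div_cpow {d : ℕ} {b : ℝ} (hb : 2 < b) {g : ℕ+ → ℂ}
    (hg : ∀ n : ℕ+, ‖g n‖ ≤ (n : ℝ) * (tau d n : ℝ)) :
    Summable fun n : ℕ+ ↦ ‖g n / (n : ℂ) ^ (b : ℂ)‖ := by
  refine (summable_tau_div_rpow d (σ := b - 1) (by linarith)).of_nonneg_of_le
    (fun _ ↦ norm_nonneg _) fun n ↦ ?_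
  have hn : (0 : ℝ) < n := by exact_mod_cast n.pos
  rw [norm_div, norm_natCast_cpow_of_pos n.pos, ofReal_re, Real.rpow_sub_one hn.ne',
    div_div_eq_mul_div, mul_comm (tau d n : ℝ)]
  gcongr
  exact hg n

section SimplePoleSeries

variable {ι : Type*} {a : ι → ℂ} {p : ι → ℝ}

lemma eventually_one_le_norm_sub (hp : Tendsto p cofinite atTop) (z : ℂ) :
    ∀ᶠ n in cofinite, 1 ≤ ‖z - p n‖ := by
  filter_upwards [hp.eventually_ge_atTop (z.re + 1)] with n hn
  have h := abs_re_le_norm (z - p n)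
  rw [sub_re, ofReal_re] at h
  linarith [neg_abs_le (z.re - p n)]

lemma summable_div_sub (ha : Summable fun n ↦ ‖a n‖) (hp : Tendsto p cofinite atTop) (z : ℂ) :
    Summable fun n ↦ a n / (z - p n) := by
  refine .of_norm_bounded_eventually ha ?_
  filter_upwards [eventually_one_le_norm_sub hp z] with n hn
  rw [norm_div]
  exact div_le_self (norm_nonneg _) hn

lemma exists_pos_le_norm_sub (hp : Tendsto p cofinite atTop) {z : ℂ}
    (hz : ∀ n, a n ≠ 0 → z ≠ p n) :
    ∃ δ > 0, ∀ n, a n ≠ 0 → δ ≤ ‖z - p n‖ := by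
  have hfin : {n | ¬ 1 ≤ ‖z - p n‖}.Finite := eventually_one_le_norm_sub hp z
  have hev : ∀ᶠ δ in 𝓝[>] (0 : ℝ), ∀ n ∈ {n | ¬ 1 ≤ ‖z - p n‖}, a n ≠ 0 → δ ≤ ‖z - p n‖ := by
    refine (eventually_all_finite hfin).mpr fun n _ ↦ ?_
    by_cases h : a n = 0
    · simp [h]
    · have hpos : 0 < ‖z - p n‖ := norm_pos_iff.mpr (sub_ne_zero.mpr (hz n h))
      filter_upwards [nhdsWithin_le_nhds (Iic_mem_nhds hpos)] with δ hδ _ using hδ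
  have hev_one : ∀ᶠ δ in 𝓝[>] (0 : ℝ), δ ≤ 1 := nhdsWithin_le_nhds (Iic_mem_nhds one_pos)
  obtain ⟨δ, ⟨hδ, hδ1⟩, hδ0⟩ := ((hev.and hev_one).and self_mem_nhdsWithin).exists
  refine ⟨δ, hδ0, fun n hn ↦ ?_⟩
  by_cases h : 1 ≤ ‖z - p n‖
  · exact le_trans hδ1 h
  · exact hδ n h hn

lemma analyticAt_tsum_div_sub (ha : Summable fun n ↦ ‖a n‖) (hp : Tendsto p cofinite atTop)
    {z : ℂ} (hz : ∀ n, a n ≠ 0 → z ≠ p n) :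
    AnalyticAt ℂ (fun w ↦ ∑' n, a n / (w - p n)) z := by
  obtain ⟨δ, hδ, h⟩ := exists_pos_le_norm_sub hp hz
  have key : ∀ n, a n ≠ 0 → ∀ w ∈ Metric.ball z (δ / 2), δ / 2 ≤ ‖w - p n‖ := by
    intro n hn w hw
    rw [mem_ball_iff_norm'] at hw
    have := norm_sub_le_norm_sub_add_norm_sub z w (p n : ℂ)
    linarith [h n hn]
  refine DifferentiableOn.analyticAt (s := Metric.ball z (δ / 2))
    (differentiableOn_tsum_of_summable_norm (ha.div_const (δ / 2)) (fun n ↦ ?_)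
      Metric.isOpen_ball fun n w hw ↦ ?_) (Metric.ball_mem_nhds z (half_pos hδ))
  · by_cases hn : a n = 0
    · simp [hn]
    · refine (differentiableOn_const _).div (by fun_prop) fun w hw h0 ↦ ?_
      have := key n hn w hw
      rw [h0, norm_zero] at this
      linarith
  · by_cases hn : a n = 0
    · simp [hn]
    · rw [norm_div]
      gcongr
      exact key n hn w hw

/-- Splitting off the term of index `m`, what remains is analytic at its pole. -/
lemma exists_analyticAt_tsum_div_sub_eq (ha : Summable fun n ↦ ‖a n‖)
    (hp : Tendsto p cofinite atTop) (hinj : Function.Injective p) (m : ι) :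
    ∃ R : ℂ → ℂ, AnalyticAt ℂ R (p m) ∧
      ∀ w, ∑' n, a n / (w - p n) = a m / (w - p m) + R w := by
  classical
  refine ⟨fun w ↦ ∑' n, (if n = m then 0 else a n) / (w - p n),
    analyticAt_tsum_div_sub (ha.of_nonneg_of_le (fun _ ↦ norm_nonneg _) fun n ↦ ?_) hp
      fun n hn h ↦ ?_, fun w ↦ ?_⟩
  · split_ifs <;> simp
  · exact hn (if_pos (hinj (ofReal_injective h)).symm)
  · rw [(summable_div_sub ha hp w).tsum_eq_add_tsum_ite m]
    congr 1
    refine tsum_congr fun n ↦ ?_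
    split_ifs <;> simp

lemma meromorphicAt_tsum_div_sub (ha : Summable fun n ↦ ‖a n‖) (hp : Tendsto p cofinite atTop)
    (hinj : Function.Injective p) (z : ℂ) :
    MeromorphicAt (fun w ↦ ∑' n, a n / (w - p n)) z := by
  by_cases hz : ∃ m, z = p m
  · obtain ⟨m, rfl⟩ := hz
    obtain ⟨R, hR, hS⟩ := exists_analyticAt_tsum_div_sub_eq ha hp hinj m
    simp_rw [hS]
    exact ((MeromorphicAt.const _ _).div ((MeromorphicAt.id _).sub (.const _ _))).add
      hR.meromorphicAt
  · push Not at hz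
    exact (analyticAt_tsum_div_sub ha hp fun n _ ↦ hz n).meromorphicAt

lemma tendsto_sub_mul_tsum_div_sub (ha : Summable fun n ↦ ‖a n‖)
    (hp : Tendsto p cofinite atTop) (hinj : Function.Injective p) (m : ι) :
    Tendsto (fun w ↦ (w - p m) * ∑' n, a n / (w - p n)) (𝓝[≠] (p m : ℂ)) (𝓝 (a m)) := by
  obtain ⟨R, hR, hS⟩ := exists_analyticAt_tsum_div_sub_eq ha hp hinj m
  have hlim : Tendsto (fun w : ℂ ↦ a m + (w - p m) * R w) (𝓝[≠] (p m : ℂ)) (𝓝 (a m)) := by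
    have hc : ContinuousAt (fun w : ℂ ↦ a m + (w - p m) * R w) (p m) :=
      continuousAt_const.add ((continuousAt_id.sub continuousAt_const).mul hR.continuousAt)
    simpa using hc.tendsto.mono_left nhdsWithin_le_nhds
  refine hlim.congr' ?_
  filter_upwards [self_mem_nhdsWithin] with w hw
  rw [hS, mul_add, mul_div_cancel₀ _ (sub_ne_zero.mpr hw)]

/-- Termwise integration of a general Dirichlet series with frequencies `p n` against
`exp (i t z)` along the half-line. -/
lemma integral_tsum_mul_exp_eq [Countable ι] (ha : Summable fun n ↦ ‖a n‖) {z : ℂ}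
    (hz : 0 < z.im) :
    ∫ t in Set.Ioi (0 : ℝ), ∑' n, a n * Complex.exp ((z - p n) * I * t) * I =
      -∑' n, a n / (z - p n) := by
  have hre : ∀ n, ((z - p n) * I).re < 0 := fun n ↦ by simpa using hz
  have hint : ∀ n, Integrable (fun t : ℝ ↦ a n * Complex.exp ((z - p n) * I * t) * I)
      (volume.restrict (Set.Ioi 0)) := fun n ↦
    ((integrableOn_exp_mul_complex_Ioi (hre n) 0).const_mul _).mul_const _
  have hsum : Summable fun n ↦ ∫ t in Set.Ioi (0 : ℝ),
      ‖a n * Complex.exp ((z - p n) * I * t) * I‖ := by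
    refine (ha.mul_right (∫ t in Set.Ioi (0 : ℝ), Real.exp (-z.im * t))).congr fun n ↦ ?_
    rw [← integral_const_mul]
    simp [Complex.norm_exp]
  rw [← integral_tsum_of_summable_integral_norm hint hsum, ← tsum_neg]
  refine tsum_congr fun n ↦ ?_
  have hne : z - p n ≠ 0 := fun h ↦ by simpa [h] using hre n
  rw [integral_mul_const, integral_const_mul, integral_exp_mul_complex_Ioi (hre n)]
  simp only [ofReal_zero, mul_zero, Complex.exp_zero]
  field_simp

end SimplePoleSeries

lemma tendsto_log_pnat_cofinite_atTop :
    Tendsto (fun n : ℕ+ ↦ Real.log n) cofinite atTop := by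
  have h : Tendsto (fun n : ℕ+ ↦ (n : ℕ)) cofinite atTop :=
    Nat.cofinite_eq_atTop ▸ PNat.coe_injective.tendsto_cofinite
  exact Real.tendsto_log_atTop.comp (tendsto_natCast_atTop_atTop.comp h)

lemma injective_log_pnat : Function.Injective fun n : ℕ+ ↦ Real.log n := fun m n h ↦ by
  have := Real.log_injOn_pos (Set.mem_Ioi.mpr (by exact_mod_cast m.pos))
    (Set.mem_Ioi.mpr (by exact_mod_cast n.pos)) h
  exact_mod_cast this

lemma natCast_cpow_eq_exp_log {n : ℕ} (hn : n ≠ 0) (s : ℂ) :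
    (n : ℂ) ^ s = Complex.exp (Real.log n * s) := by
  rw [cpow_def_of_ne_zero (Nat.cast_ne_zero.mpr hn), natCast_log]

/-- For `b > 2` and coefficients `g(n)` with `|g(n)| ≤ n·τ_d(n)`, the integral
`∫_b^{b+i∞} (∑ g(n) n^{-s}) e^{zs} ds` (over the ray `s = b + it`, `t ≥ 0`)
equals `-e^{bz} ∑_{n≥1} g(n)/(n^b (z - log n))` for every `z` in the upper
half-plane; the series defines a meromorphic function of `z` on all of `ℂ`
which is analytic away from the points `log n` with `g(n) ≠ 0` and has a
simple pole (with residue `-g(n)`) at each point `z = log n` with `g(n) ≠ 0`. -/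
theorem vertical_integral_eq_meromorphic_series (d : ℕ) (b : ℝ) (hb : 2 < b)
    (g : ℕ+ → ℂ) (hg : ∀ n : ℕ+, ‖g n‖ ≤ (n : ℝ) * (tau d n : ℝ)) :
    (∀ z : ℂ, 0 < z.im →
      ∫ t in Set.Ioi (0 : ℝ),
          (∑' n : ℕ+, g n * (n : ℂ) ^ (-((b : ℂ) + t * I))) *
            Complex.exp (z * ((b : ℂ) + t * I)) * I =
        -Complex.exp ((b : ℂ) * z) *
          ∑' n : ℕ+, g n / ((n : ℂ) ^ (b : ℂ) * (z - Real.log n))) ∧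
    MeromorphicOn (fun z : ℂ =>
      -Complex.exp ((b : ℂ) * z) *
        ∑' n : ℕ+, g n / ((n : ℂ) ^ (b : ℂ) * (z - Real.log n))) Set.univ ∧
    (∀ z : ℂ, (∀ n : ℕ+, g n ≠ 0 → z ≠ (Real.log n : ℂ)) →
      AnalyticAt ℂ (fun z : ℂ =>
        -Complex.exp ((b : ℂ) * z) *
          ∑' n : ℕ+, g n / ((n : ℂ) ^ (b : ℂ) * (z - Real.log n))) z) ∧
    ∀ m : ℕ+, g m ≠ 0 →
      Tendsto (fun z : ℂ =>
          (z - Real.log m) *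
            (-Complex.exp ((b : ℂ) * z) *
              ∑' n : ℕ+, g n / ((n : ℂ) ^ (b : ℂ) * (z - Real.log n))))
        (𝓝[≠] ((Real.log m : ℝ) : ℂ)) (𝓝 (-(g m))) := by
  have ha := summable_norm_div_cpow hb hg
  have hp := tendsto_log_pnat_cofinite_atTop
  have hinj := injective_log_pnat
  have hcpow (n : ℕ+) : (n : ℂ) ^ (b : ℂ) ≠ 0 := by
    rw [natCast_cpow_eq_exp_log n.ne_zero]
    exact Complex.exp_ne_zero _
  have hexp : AnalyticOnNhd ℂ (fun z : ℂ ↦ -Complex.exp ((b : ℂ) * z)) Set.univ :=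
    fun z _ ↦ by fun_prop
  simp_rw [← div_div]
  refine ⟨fun z hz ↦ ?_, fun z _ ↦ ?_, fun z hz ↦ ?_, fun m _ ↦ ?_⟩
  · rw [neg_mul, ← mul_neg, ← integral_tsum_mul_exp_eq ha hz, ← integral_const_mul]
    refine integral_congr_ae (Eventually.of_forall fun t ↦ ?_)
    simp only [← tsum_mul_left, ← tsum_mul_right]
    refine tsum_congr fun n ↦ ?_
    rw [natCast_cpow_eq_exp_log n.ne_zero, natCast_cpow_eq_exp_log n.ne_zero, div_eq_mul_inv,
      ← Complex.exp_neg]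
    trans g n * I * Complex.exp (Real.log n * -(b + t * I) + z * (b + t * I))
    · rw [Complex.exp_add]; ring
    · rw [show (Real.log n : ℂ) * -(b + t * I) + z * (b + t * I) =
        b * z + -(Real.log n * b) + (z - Real.log n) * I * t by ring, Complex.exp_add,
        Complex.exp_add]
      ring
  · exact (hexp z trivial).meromorphicAt.mul (meromorphicAt_tsum_div_sub ha hp hinj z)
  · exact (hexp z trivial).mul (analyticAt_tsum_div_sub ha hp fun n hn ↦
      hz n fun h ↦ hn (by simp [h]))
  · have h := ((hexp (Real.log m) trivial).continuousAt.tendsto.mono_left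
      nhdsWithin_le_nhds).mul (tendsto_sub_mul_tsum_div_sub ha hp hinj m)
    rw [mul_comm (b : ℂ), ← natCast_cpow_eq_exp_log m.ne_zero, neg_mul,
      mul_div_cancel₀ _ (hcpow m)] at h
    exact h.congr fun w ↦ by ring
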